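/- Let G and H be modules over a principal ideal domain R, p a prime of R, and φ an isomorphism between a finitely generated submodule S of G and a submodule T of H that preserves p-heights up to α for some ordinal α. Suppose û_p(σ,G) ≤ û_p(σ,H) for all ordinals σ < α. If x ∈ G is proper with respect to S, px ∈ S, and |x|_p + 1 < α, then there exists y ∈ H such that φ extends to an isomorphism φ* : ⟨S,x⟩ → ⟨T,y⟩ (with φ*(x) = y) that preserves p-heights up to α. -/

import Mathlib

noncomputable section

namespace UlmW

universe u

variable {R : Type*} [CommRing R]

/-- The submodule `p^α M`, defined by transfinite recursion on `α`. -/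
def ppow {M : Type u} [AddCommGroup M] [Module R M] (p : R) (α : Ordinal.{u}) :
    Submodule R M :=
  Ordinal.limitRecOn α ⊤ (fun _ S => Submodule.map (LinearMap.lsmul R M p) S)
    fun β _ ih => ⨅ (γ : Set.Iio β), ih γ.1 γ.2

open scoped Classical in
/-- The `p`-height of `x`, with `⊤` playing the role of `∞`. -/
def pheight {M : Type u} [AddCommGroup M] [Module R M] (p : R) (x : M) :
    WithTop Ordinal.{u} :=
  if h : ∃ α : Ordinal.{u}, x ∈ ppow p α ∧ x ∉ ppow p (α + 1) then (h.choose : WithTop Ordinal)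
  else ⊤

/-- `H⁰ = {x : ∃ a ≠ 0, a • x ∈ H}`. -/
def hull {M : Type u} [AddCommGroup M] [Module R M] (H : Submodule R M) : Set M :=
  {x | ∃ a : R, a ≠ 0 ∧ a • x ∈ H}

/-- `X` is a decomposition set with respect to the single prime `p`. -/
def IsDecompWrt {M : Type u} [AddCommGroup M] [Module R M] (p : R) (X : Set M) : Prop :=
  (LinearIndependent R (fun x : X => (x : M))) ∧
  (∀ x ∈ X, ∀ a : R, a ≠ 0 → a • x ≠ 0) ∧
  (∀ s : Finset M, ↑s ⊆ X → ∀ c : M → R,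
    pheight p (∑ x ∈ s, c x • x) = s.inf fun x => pheight p (c x • x))

/-- `X` is a decomposition set (with respect to every prime of `R`). -/
def IsDecompositionSet (R : Type*) [CommRing R] {M : Type u} [AddCommGroup M] [Module R M]
    (X : Set M) : Prop :=
  ∀ p : R, Prime p → IsDecompWrt p X

/-- partial decomposition basis, heights taken w.r.t. a fixed prime `p`. -/
def IsPDBWrt {M : Type u} [AddCommGroup M] [Module R M] (p : R) (C : Set (Set M)) : Prop :=
  C.Nonempty ∧ (∀ X ∈ C, X.Finite) ∧ (∀ X ∈ C, IsDecompWrt p X) ∧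
  ∀ X ∈ C, ∀ x : M, ∃ Y ∈ C, X ⊆ Y ∧ x ∈ hull (Submodule.span R Y)

/-- partial decomposition basis (heights w.r.t. all primes of `R`). -/
def IsPDB (R : Type*) [CommRing R] {M : Type u} [AddCommGroup M] [Module R M] (C : Set (Set M)) : Prop :=
  C.Nonempty ∧ (∀ X ∈ C, X.Finite) ∧ (∀ X ∈ C, IsDecompositionSet R X) ∧
  ∀ X ∈ C, ∀ x : M, ∃ Y ∈ C, X ⊆ Y ∧ x ∈ hull (Submodule.span R Y)

/-- A partial isomorphism system `I : G ≅_p H`. -/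
def IsPartialIsoSystem {M N : Type*} [AddCommGroup M] [Module R M]
    [AddCommGroup N] [Module R N] (I : Set (M →ₗ.[R] N)) : Prop :=
  I.Nonempty ∧
  (∀ f ∈ I, Function.Injective f.toFun) ∧
  (∀ f ∈ I, ∀ a : M, ∃ g ∈ I, f ≤ g ∧ a ∈ g.domain) ∧
  (∀ f ∈ I, ∀ b : N, ∃ g ∈ I, f ≤ g ∧ ∃ y : g.domain, g y = b)

/-- The Ulm sequence of `x`: `U(x) = (|pⁱ x|)ᵢ`. -/
def UlmSeqOf {M : Type u} [AddCommGroup M] [Module R M] (p : R) (x : M) :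
    ℕ → WithTop Ordinal.{u} :=
  fun i => pheight p ((p ^ i) • x)

/-- `u` is an Ulm sequence. -/
def IsUlmSeq (u : ℕ → WithTop Ordinal.{u}) : Prop :=
  ∀ i, (u i = ⊤ → u (i + 1) = ⊤) ∧ (u i ≠ ⊤ → u i < u (i + 1))

/-- Equivalence of Ulm sequences. -/
def UlmEquiv (u v : ℕ → WithTop Ordinal.{u}) : Prop :=
  ∃ m n : ℕ, ∀ i, u (i + n) = v (i + m)

/-- `X` contains at least `n` elements whose Ulm sequence is equivalent to `u`. -/
def HasAtLeast {M : Type u} [AddCommGroup M] [Module R M] (p : R)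
    (u : ℕ → WithTop Ordinal.{u}) (n : ℕ) (X : Set M) : Prop :=
  ∃ s : Finset M, ↑s ⊆ X ∧ n ≤ s.card ∧ ∀ x ∈ s, UlmEquiv (UlmSeqOf p x) u

/-- `ŵ_C(e,G)` where `e` is the class of the Ulm sequence `u`. -/
def wHat {M : Type u} [AddCommGroup M] [Module R M] (p : R) (C : Set (Set M))
    (u : ℕ → WithTop Ordinal.{u}) : ℕ∞ :=
  sSup {N : ℕ∞ | ∃ n : ℕ, N = (n : ℕ∞) ∧ ∃ X ∈ C, HasAtLeast p u n X}

/-- `x` is proper with respect to `S`. -/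
def IsProper {M : Type u} [AddCommGroup M] [Module R M] (p : R) (S : Submodule R M)
    (x : M) : Prop :=
  ∀ s ∈ S, pheight p (x + s) ≤ pheight p x

/-- `H` is a nice submodule. -/
def IsNice {M : Type u} [AddCommGroup M] [Module R M] (p : R) (H : Submodule R M) : Prop :=
  ∀ x : M, ∃ h ∈ H, ∀ h' ∈ H, pheight p (x + h') ≤ pheight p (x + h)

/-- The Ulm invariant `u_p(σ, M)`: the dimension of `(p^σ M)[p]/(p^{σ+1} M)[p]`
over the residue field `R/(p)`. -/
def uCard (p : R) (M : Type u) [AddCommGroup M] [Module R M] (σ : Ordinal.{u}) :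
    Cardinal :=
  let V : Submodule R M := ppow p σ ⊓ Submodule.torsionBy R M p
  let W : Submodule R V := (ppow p (σ + 1) ⊓ Submodule.torsionBy R M p).comap V.subtype
  Module.rank (R ⧸ Ideal.span {p})
    ((V ⧸ W) ⧸ (Ideal.span {p} • (⊤ : Submodule R (V ⧸ W))))

/-- `û_p(σ, M) = min (u_p(σ, M), ω)`. -/
def uHat (p : R) (M : Type u) [AddCommGroup M] [Module R M] (σ : Ordinal.{u}) : Cardinal :=
  min (uCard p M σ) Cardinal.aleph0

/-- `û_p(∞, M) = min (dim (p^∞ M)[p], ω)`. -/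
def uHatInf (p : R) (M : Type u) [AddCommGroup M] [Module R M] : Cardinal :=
  let V : Submodule R M := (⨅ α : Ordinal.{u}, ppow p α) ⊓ Submodule.torsionBy R M p
  min (Module.rank (R ⧸ Ideal.span {p})
    (V ⧸ (Ideal.span {p} • (⊤ : Submodule R V)))) Cardinal.aleph0

end UlmW

open UlmW

/-- The ideal `(p) ⊆ ℤ` is prime. -/
instance zpSpanPrime (p : ℤ) [hp : Fact (Prime p)] : (Ideal.span {p} : Ideal ℤ).IsPrime :=
  (Ideal.span_singleton_prime hp.out.ne_zero).mpr hp.out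

/-- `ℤ_(p)`, the integers localized at the prime `p`. -/
abbrev Zp (p : ℤ) [Fact (Prime p)] : Type :=
  Localization.AtPrime (Ideal.span {p} : Ideal ℤ)


universe u

open UlmW

namespace UlmW

section Height

variable {R : Type*} [CommRing R] {M : Type u} [AddCommGroup M] [Module R M] {p : R}

theorem ppow_zero : (ppow p 0 : Submodule R M) = ⊤ :=
  Ordinal.limitRecOn_zero ..

theorem ppow_add_one (α : Ordinal.{u}) :
    (ppow p (α + 1) : Submodule R M) = (ppow p α).map (LinearMap.lsmul R M p) :=
  Ordinal.limitRecOn_add_one ..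

theorem ppow_limit {α : Ordinal.{u}} (h : Order.IsSuccLimit α) :
    (ppow p α : Submodule R M) = ⨅ γ : Set.Iio α, ppow p γ.1 :=
  Ordinal.limitRecOn_limit (h := h) ..

theorem mem_ppow_add_one {α : Ordinal.{u}} {x : M} :
    x ∈ ppow p (α + 1) ↔ ∃ y ∈ ppow p α, p • y = x := by
  simp [ppow_add_one]

theorem mem_ppow_limit {α : Ordinal.{u}} (h : Order.IsSuccLimit α) {x : M} :
    x ∈ ppow p α ↔ ∀ γ < α, x ∈ ppow p γ := by
  simp [ppow_limit h]

theorem smul_mem_ppow_add_one {α : Ordinal.{u}} {x : M} (hx : x ∈ ppow p α) :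
    p • x ∈ ppow p (α + 1) :=
  mem_ppow_add_one.2 ⟨x, hx, rfl⟩

theorem ppow_add_one_le (α : Ordinal.{u}) :
    (ppow p (α + 1) : Submodule R M) ≤ ppow p α := by
  intro x hx
  obtain ⟨y, hy, rfl⟩ := mem_ppow_add_one.1 hx
  exact Submodule.smul_mem _ _ hy

theorem ppow_antitone : Antitone (fun α : Ordinal.{u} => (ppow p α : Submodule R M)) := by
  intro α β h
  induction β using Ordinal.limitRecOn with
  | zero => rw [nonpos_iff_eq_zero.1 h]
  | add_one β ih =>
    rcases h.eq_or_lt with rfl | h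
    · exact le_rfl
    · exact (ppow_add_one_le β).trans (ih (Order.lt_add_one_iff.1 h))
  | limit β hβ ih =>
    rcases h.eq_or_lt with rfl | h
    · exact le_rfl
    · exact fun x hx => (mem_ppow_limit hβ).1 hx α h

theorem coe_le_pheight_iff {β : Ordinal.{u}} {x : M} :
    (β : WithTop Ordinal.{u}) ≤ pheight p x ↔ x ∈ ppow p β := by
  unfold pheight
  split_ifs with h
  · obtain ⟨h₁, h₂⟩ := h.choose_spec
    rw [WithTop.coe_le_coe]
    refine ⟨fun hle => ppow_antitone hle h₁, fun hx => ?_⟩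
    by_contra hlt
    exact h₂ (ppow_antitone (Order.add_one_le_iff.2 (not_le.1 hlt)) hx)
  · push Not at h
    refine iff_of_true le_top ?_
    induction β using Ordinal.limitRecOn with
    | zero => simp [ppow_zero]
    | add_one β ih => exact h β ih
    | limit β hβ ih => exact (mem_ppow_limit hβ).2 ih

theorem smul_mem_ppow_iff {u : R} (hu : IsCoprime u p) {β : Ordinal.{u}} {z : M} :
    u • z ∈ ppow p β ↔ z ∈ ppow p β := by
  refine ⟨fun h => ?_, fun h => Submodule.smul_mem _ _ h⟩
  induction β using Ordinal.limitRecOn with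
  | zero => simp [ppow_zero]
  | add_one β ih =>
    have hz := ih (ppow_add_one_le β h)
    obtain ⟨a, b, hab⟩ := hu
    have : z = a • u • z + b • p • z := by
      rw [smul_smul, smul_smul, ← add_smul, hab, one_smul]
    rw [this]
    exact add_mem (Submodule.smul_mem _ _ h) (Submodule.smul_mem _ _ (smul_mem_ppow_add_one hz))
  | limit β hβ ih =>
    exact (mem_ppow_limit hβ).2 fun γ hγ => ih γ hγ ((mem_ppow_limit hβ).1 h γ hγ)

theorem preserves_pheight_iff {N : Type u} [AddCommGroup N] [Module R N] {α : Ordinal.{u}}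
    {a : M} {b : N} :
    ((pheight p a < (α : WithTop Ordinal.{u}) → pheight p b = pheight p a) ∧
      ((α : WithTop Ordinal.{u}) ≤ pheight p a → (α : WithTop Ordinal.{u}) ≤ pheight p b)) ↔
    ∀ β ≤ α, (a ∈ ppow p β ↔ b ∈ ppow p β) := by
  simp only [← coe_le_pheight_iff]
  constructor
  · rintro ⟨h₁, h₂⟩ β hβ
    rcases lt_or_ge (pheight p a) (α : WithTop Ordinal.{u}) with h | h
    · rw [h₁ h]
    · have hβ' : (β : WithTop Ordinal.{u}) ≤ α := WithTop.coe_le_coe.2 hβ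
      exact iff_of_true (hβ'.trans h) (hβ'.trans (h₂ h))
  · refine fun h => ⟨fun ha => ?_, (h α le_rfl).1⟩
    have hb : pheight p b < (α : WithTop Ordinal.{u}) :=
      lt_of_not_ge fun hb => ha.not_ge ((h α le_rfl).2 hb)
    obtain ⟨γ, hγ⟩ := WithTop.ne_top_iff_exists.1 ha.ne_top
    obtain ⟨δ, hδ⟩ := WithTop.ne_top_iff_exists.1 hb.ne_top
    rw [← hγ] at ha
    rw [← hδ] at hb
    apply le_antisymm
    · rw [← hδ]
      exact (h δ (WithTop.coe_lt_coe.1 hb).le).2 hδ.le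
    · rw [← hγ]
      exact (h γ (WithTop.coe_lt_coe.1 ha).le).1 hγ.le

end Height

section UlmInvariant

variable {R : Type*} [CommRing R] {M : Type u} [AddCommGroup M] [Module R M] {p : R}

/-- The `R/(p)`-vector space whose dimension is the Ulm invariant `u_p(σ, M)`. -/
abbrev UlmQuotient (p : R) (M : Type u) [AddCommGroup M] [Module R M] (σ : Ordinal.{u}) :
    Type u :=
  let V : Submodule R M := ppow p σ ⊓ Submodule.torsionBy R M p
  let W : Submodule R V := (ppow p (σ + 1) ⊓ Submodule.torsionBy R M p).comap V.subtype
  (V ⧸ W) ⧸ (Ideal.span {p} • (⊤ : Submodule R (V ⧸ W)))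

theorem uCard_eq_rank (σ : Ordinal.{u}) :
    uCard p M σ = Module.rank (R ⧸ Ideal.span {p}) (UlmQuotient p M σ) :=
  rfl

/-- The projection of `(p^σ M)[p]` onto the vector space computing the Ulm invariant. -/
def ulmMk (p : R) (M : Type u) [AddCommGroup M] [Module R M] (σ : Ordinal.{u}) :
    ↥(ppow p σ ⊓ Submodule.torsionBy R M p) →ₗ[R] UlmQuotient p M σ :=
  (Submodule.mkQ _).comp (Submodule.mkQ _)

theorem ulmMk_surjective (σ : Ordinal.{u}) : Function.Surjective (ulmMk p M σ) :=
  (Submodule.mkQ_surjective _).comp (Submodule.mkQ_surjective _)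

theorem ulmMk_eq_zero_iff {σ : Ordinal.{u}} {v : ↥(ppow p σ ⊓ Submodule.torsionBy R M p)} :
    ulmMk p M σ v = 0 ↔ (v : M) ∈ ppow p (σ + 1) := by
  have hv : p • (v : M) = 0 := (Submodule.mem_torsionBy_iff p _).1 v.2.2
  simp only [ulmMk, LinearMap.comp_apply, Submodule.mkQ_apply, Submodule.Quotient.mk_eq_zero]
  constructor
  · intro h
    have hbot : ∀ q ∈ (Ideal.span {p} • (⊤ : Submodule R
        (↥(ppow p σ ⊓ Submodule.torsionBy R M p) ⧸
          (ppow p (σ + 1) ⊓ Submodule.torsionBy R M p).comap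
            (ppow p σ ⊓ Submodule.torsionBy R M p).subtype))), q = 0 := by
      intro q hq
      refine Submodule.smul_induction_on hq ?_ ?_
      · intro r hr n _
        obtain ⟨c, rfl⟩ := Ideal.mem_span_singleton'.1 hr
        obtain ⟨w, rfl⟩ := Submodule.mkQ_surjective _ n
        have hw : p • w = 0 := Subtype.ext ((Submodule.mem_torsionBy_iff p _).1 w.2.2)
        rw [mul_smul, ← map_smul, hw, map_zero, smul_zero]
      · rintro a b rfl rfl
        exact add_zero 0
    exact ((Submodule.Quotient.mk_eq_zero _).1 (hbot _ h)).1
  · intro h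
    have hv₀ : v ∈ (ppow p (σ + 1) ⊓ Submodule.torsionBy R M p).comap
        (ppow p σ ⊓ Submodule.torsionBy R M p).subtype := ⟨h, v.2.2⟩
    rw [(Submodule.Quotient.mk_eq_zero _).2 hv₀]
    exact zero_mem _

theorem linearIndependent_ulmMk_iff {ι : Type*} [Fintype ι] {σ : Ordinal.{u}}
    {v : ι → ↥(ppow p σ ⊓ Submodule.torsionBy R M p)} :
    LinearIndependent (R ⧸ Ideal.span {p}) (fun i => ulmMk p M σ (v i)) ↔
      ∀ r : ι → R, ∑ i, r i • (v i : M) ∈ ppow p (σ + 1) → ∀ i, p ∣ r i := by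
  rw [Fintype.linearIndependent_iff]
  have key : ∀ r : ι → R,
      ∑ i, (Ideal.Quotient.mk (Ideal.span {p}) (r i)) • ulmMk p M σ (v i) = 0 ↔
        ∑ i, r i • (v i : M) ∈ ppow p (σ + 1) := by
    intro r
    have : ∑ i, (Ideal.Quotient.mk (Ideal.span {p}) (r i)) • ulmMk p M σ (v i) =
        ulmMk p M σ (∑ i, r i • v i) := by
      rw [map_sum]
      refine Finset.sum_congr rfl fun i _ => ?_
      rw [map_smul]
      rfl
    rw [this, ulmMk_eq_zero_iff]
    simp
  constructor
  · intro h r hr i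
    have := h _ ((key r).2 hr) i
    rwa [Ideal.Quotient.eq_zero_iff_mem, Ideal.mem_span_singleton] at this
  · intro h g hg i
    choose r hr using fun i => Ideal.Quotient.mk_surjective (g i)
    obtain rfl : (fun i => Ideal.Quotient.mk _ (r i)) = g := funext hr
    have := h r ((key r).1 hg) i
    rwa [Ideal.Quotient.eq_zero_iff_mem, Ideal.mem_span_singleton]

theorem card_le_uCard (hp : Prime p) {ι : Type} [Fintype ι] {σ : Ordinal.{u}} {v : ι → M}
    (hv : ∀ i, v i ∈ ppow p σ) (hv' : ∀ i, p • v i = 0)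
    (hind : ∀ r : ι → R, ∑ i, r i • v i ∈ ppow p (σ + 1) → ∀ i, p ∣ r i) :
    (Fintype.card ι : Cardinal) ≤ uCard p M σ := by
  have : Nontrivial (R ⧸ Ideal.span {p}) :=
    Ideal.Quotient.nontrivial_iff.2 fun h => hp.not_isUnit (Ideal.span_singleton_eq_top.1 h)
  have h := (linearIndependent_ulmMk_iff (p := p) (σ := σ)
    (v := fun i => ⟨v i, hv i, (Submodule.mem_torsionBy_iff p _).2 (hv' i)⟩)).2 hind
  have := h.cardinal_lift_le_rank
  rw [uCard_eq_rank]
  simpa using this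

theorem finite_ulmQuotient [IsNoetherianRing R] {T : Submodule R M} (hT : T.FG)
    {σ : Ordinal.{u}}
    (h : ∀ w ∈ ppow p σ, p • w = 0 → ∃ t ∈ T, w + t ∈ ppow p (σ + 1)) :
    Module.Finite R (UlmQuotient p M σ) := by
  set A : Submodule R M := ppow p (σ + 1)
  set f : ↥(ppow p σ ⊓ Submodule.torsionBy R M p) →ₗ[R] M ⧸ A :=
    A.mkQ.comp (Submodule.subtype _) with hf
  have hle : LinearMap.range f ≤ T.map A.mkQ := by
    rintro _ ⟨w, rfl⟩
    obtain ⟨t, ht, hwt⟩ := h w w.2.1 ((Submodule.mem_torsionBy_iff p _).1 w.2.2)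
    refine ⟨-t, neg_mem ht, ?_⟩
    simp only [hf, LinearMap.comp_apply, Submodule.mkQ_apply, Submodule.subtype_apply]
    rw [eq_comm, Submodule.Quotient.eq, sub_neg_eq_add]
    exact hwt
  have hN : IsNoetherian R (T.map A.mkQ) :=
    isNoetherian_of_fg_of_noetherian _ (hT.map _)
  have hN' : IsNoetherian R (LinearMap.range f) := isNoetherian_of_le hle
  have hker : LinearMap.ker f ≤ LinearMap.ker (ulmMk p M σ) := by
    intro v hv
    rw [LinearMap.mem_ker] at hv ⊢
    rw [ulmMk_eq_zero_iff]
    exact (Submodule.Quotient.mk_eq_zero _).1 hv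
  let g : LinearMap.range f →ₗ[R] UlmQuotient p M σ :=
    ((LinearMap.ker f).liftQ (ulmMk p M σ) hker).comp f.quotKerEquivRange.symm.toLinearMap
  refine Module.Finite.of_surjective g fun q => ?_
  obtain ⟨v, rfl⟩ := ulmMk_surjective σ q
  refine ⟨f.quotKerEquivRange (Submodule.Quotient.mk v), ?_⟩
  change (LinearMap.ker f).liftQ (ulmMk p M σ) hker
    (f.quotKerEquivRange.symm (f.quotKerEquivRange (Submodule.Quotient.mk v))) = _
  rw [LinearEquiv.symm_apply_apply]
  rfl

theorem exists_basis_of_fg [IsDomain R] [IsPrincipalIdealRing R] (hp : Prime p)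
    {T : Submodule R M} (hT : T.FG) {σ : Ordinal.{u}}
    (h : ∀ w ∈ ppow p σ, p • w = 0 → ∃ t ∈ T, w + t ∈ ppow p (σ + 1)) :
    ∃ (n : ℕ) (v : Fin n → M), uCard p M σ = n ∧ (∀ i, v i ∈ ppow p σ) ∧
      (∀ i, p • v i = 0) ∧
      ∀ r : Fin n → R, ∑ i, r i • v i ∈ ppow p (σ + 1) → ∀ i, p ∣ r i := by
  have := finite_ulmQuotient hT h
  have : (Ideal.span {p}).IsMaximal := PrincipalIdealRing.isMaximal_of_irreducible hp.irreducible
  let _ : Field (R ⧸ Ideal.span {p}) := Ideal.Quotient.field _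
  have : Module.Finite (R ⧸ Ideal.span {p}) (UlmQuotient p M σ) :=
    Module.Finite.of_restrictScalars_finite R _ _
  let b := Module.finBasis (R ⧸ Ideal.span {p}) (UlmQuotient p M σ)
  choose v hv using fun i => ulmMk_surjective σ (b i)
  refine ⟨_, fun i => v i, (Module.finrank_eq_rank _ _).symm, fun i => (v i).2.1,
    fun i => (Submodule.mem_torsionBy_iff p _).1 (v i).2.2, ?_⟩
  rw [← linearIndependent_ulmMk_iff]
  simp only [hv]
  exact b.linearIndependent

end UlmInvariant

section Extension

variable {R : Type*} [CommRing R] {G H : Type u} [AddCommGroup G] [Module R G]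
  [AddCommGroup H] [Module R H] {p : R} {S : Submodule R G} {T : Submodule R H}

theorem exists_linearEquiv_of_ker_eq {N : Type*} [AddCommGroup N] [Module R N]
    (f : N →ₗ[R] G) (g : N →ₗ[R] H) (h : LinearMap.ker f = LinearMap.ker g)
    {A : Submodule R G} {B : Submodule R H} (hA : LinearMap.range f = A)
    (hB : LinearMap.range g = B) :
    ∃ ψ : A ≃ₗ[R] B, ∀ n (hn : f n ∈ A), (ψ ⟨f n, hn⟩ : H) = g n := by
  subst hA hB
  refine ⟨f.quotKerEquivRange.symm ≪≫ₗ Submodule.quotEquivOfEq _ _ h ≪≫ₗ g.quotKerEquivRange,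
    fun n hn => ?_⟩
  have : f.quotKerEquivRange.symm ⟨f n, hn⟩ = Submodule.Quotient.mk n :=
    (LinearEquiv.symm_apply_eq _).2 rfl
  simp [this]

theorem range_coprod_toSpanSingleton {N : Type*} [AddCommGroup N] [Module R N]
    (f : N →ₗ[R] G) (x : G) :
    LinearMap.range (f.coprod (LinearMap.toSpanSingleton R G x)) =
      LinearMap.range f ⊔ Submodule.span R {x} := by
  rw [LinearMap.range_coprod, LinearMap.range_toSpanSingleton]

/-- If all elements of `(p^σ H)[p]` lie in `T` modulo `p^(σ+1) H`, then the Ulm invariant of `H`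
at `σ` is strictly smaller than that of `G`. -/
theorem exists_torsion_add_notMem [IsDomain R] [IsPrincipalIdealRing R] (hp : Prime p)
    (hSfg : S.FG) (φ : S ≃ₗ[R] T) {α σ : Ordinal.{u}} (hσ : σ + 1 < α)
    (hφ : ∀ z : S, ∀ β ≤ α, ((z : G) ∈ ppow p β ↔ (φ z : H) ∈ ppow p β))
    (hu : uHat p G σ ≤ uHat p H σ) {e : G} (he : e ∈ ppow p σ) (hpe : p • e = 0)
    (heS : ∀ s ∈ S, e + s ∉ ppow p (σ + 1)) :
    ∃ w ∈ ppow p σ, p • w = 0 ∧ ∀ t ∈ T, w + t ∉ (ppow p (σ + 1) : Submodule R H) := by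
  by_contra! hcon
  have hTfg : T.FG := by
    have : Module.Finite R S := Module.Finite.iff_fg.2 hSfg
    exact Module.Finite.iff_fg.1 (Module.Finite.equiv φ)
  have hσα : σ ≤ α := (le_add_of_nonneg_right zero_le_one).trans hσ.le
  have hσ₂ : σ + 1 + 1 ≤ α := Order.add_one_le_iff.2 hσ
  obtain ⟨n, w, hn, hw, hpw, hind⟩ := exists_basis_of_fg hp hTfg hcon
  choose t ht hwt using fun i => hcon (w i) (hw i) (hpw i)
  set s : Fin n → S := fun i => φ.symm ⟨t i, ht i⟩ with hs
  have hφs : ∀ i, (φ (s i) : H) = t i := fun i => by simp [hs]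
  have hsσ : ∀ i, (s i : G) ∈ ppow p σ := by
    intro i
    rw [hφ _ _ hσα, hφs]
    exact (add_mem_cancel_left (hw i)).1 (ppow_add_one_le σ (hwt i))
  have hps : ∀ i, ∃ v ∈ (ppow p (σ + 1) : Submodule R G), p • v = p • (s i : G) := by
    intro i
    rw [← mem_ppow_add_one]
    have h := (hφ (p • s i) _ hσ₂).2
    rw [map_smul, Submodule.coe_smul, Submodule.coe_smul, hφs] at h
    apply h
    have := smul_mem_ppow_add_one (hwt i)
    rwa [smul_add, hpw, zero_add] at this
  choose v hv hpv using hps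
  have hle : (Fintype.card (Option (Fin n)) : Cardinal) ≤ uCard p G σ := by
    refine card_le_uCard (v := fun o => o.elim e fun i => s i - v i) hp ?_ ?_ ?_
    · rintro (_ | i)
      · exact he
      · exact sub_mem (hsσ i) (ppow_add_one_le σ (hv i))
    · rintro (_ | i)
      · exact hpe
      · simp [smul_sub, hpv]
    · intro r hr
      rw [Fintype.sum_option] at hr
      simp only [Option.elim_none, Option.elim_some, smul_sub, Finset.sum_sub_distrib] at hr
      have hvs : ∑ i, r (some i) • v i ∈ (ppow p (σ + 1) : Submodule R G) :=
        sum_mem fun i _ => Submodule.smul_mem _ _ (hv i)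
      have hr' : r none • e + ∑ i, r (some i) • (s i : G) ∈ ppow p (σ + 1) := by
        have := add_mem hr hvs
        rwa [add_assoc, sub_add_cancel] at this
      have h₀ : p ∣ r none := by
        by_contra hnd
        obtain ⟨a, b, hab⟩ := (hp.irreducible.coprime_iff_not_dvd.2 hnd)
        refine heS (b • ∑ i, r (some i) • (s i : G)) ?_ ?_
        · exact Submodule.smul_mem _ _ (sum_mem fun i _ => Submodule.smul_mem _ _ (s i).2)
        · have h := Submodule.smul_mem _ b hr'
          have hb : b • r none • e = e := by
            rw [smul_smul, eq_sub_of_add_eq' hab, sub_smul, mul_smul, hpe, smul_zero, sub_zero,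
              one_smul]
          rwa [smul_add, hb] at h
      obtain ⟨c, hc⟩ := h₀
      rw [hc, mul_comm, mul_smul, hpe, smul_zero, zero_add] at hr'
      have hφr : ∑ i, r (some i) • t i ∈ (ppow p (σ + 1) : Submodule R H) := by
        have := (hφ (∑ i, r (some i) • s i) _ hσ.le).1 (by simpa using hr')
        simpa [hφs] using this
      have hwr : ∑ i, r (some i) • w i ∈ (ppow p (σ + 1) : Submodule R H) := by
        have h : ∑ i, r (some i) • (w i + t i) ∈ (ppow p (σ + 1) : Submodule R H) :=
          sum_mem fun i _ => Submodule.smul_mem _ _ (hwt i)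
        simp only [smul_add, Finset.sum_add_distrib] at h
        exact (add_mem_cancel_right hφr).1 h
      rintro (_ | i)
      · exact ⟨c, hc⟩
      · exact hind _ hwr i
  have h₁ : ((n + 1 : ℕ) : Cardinal.{u}) ≤ uHat p G σ :=
    le_min (by simpa using hle) Cardinal.natCast_le_aleph0
  have h₂ : uHat p H σ ≤ (n : Cardinal.{u}) := (min_le_left _ _).trans hn.le
  have := Nat.cast_le.1 (h₁.trans (hu.trans h₂))
  omega

theorem exists_image_of_proper [IsDomain R] [IsPrincipalIdealRing R] (hp : Prime p)
    (hSfg : S.FG) (φ : S ≃ₗ[R] T) {α σ : Ordinal.{u}} (hσ : σ + 1 < α)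
    (hφ : ∀ z : S, ∀ β ≤ α, ((z : G) ∈ ppow p β ↔ (φ z : H) ∈ ppow p β))
    (hu : uHat p G σ ≤ uHat p H σ) {x : G} (hxσ : x ∈ ppow p σ) (hpx : p • x ∈ S)
    (hx : ∀ s ∈ S, x + s ∉ ppow p (σ + 1)) :
    ∃ y ∈ ppow p σ, p • y = (φ ⟨p • x, hpx⟩ : H) ∧
      ∀ t ∈ T, y + t ∉ (ppow p (σ + 1) : Submodule R H) := by
  have hσα : σ ≤ α := (le_add_of_nonneg_right zero_le_one).trans hσ.le
  have hσ₂ : σ + 1 + 1 ≤ α := Order.add_one_le_iff.2 hσ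
  have hφ_add : ∀ s : S, (φ (⟨p • x, hpx⟩ + p • s) : H) = φ ⟨p • x, hpx⟩ + p • (φ s : H) := by
    intro s
    simp
  by_cases hA : ∃ s : S, (s : G) ∈ ppow p σ ∧ p • (x + s) ∈ ppow p (σ + 1 + 1)
  · obtain ⟨s, hs, hxs⟩ := hA
    have hxs' := hxs
    obtain ⟨v, hv, hpv⟩ := mem_ppow_add_one.1 hxs
    obtain ⟨w, hw, hpw⟩ := mem_ppow_add_one.1
      ((hφ (⟨p • x, hpx⟩ + p • s) _ hσ₂).1 (by simpa [smul_add] using hxs'))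
    obtain ⟨e, he, hpe, heT⟩ := exists_torsion_add_notMem hp hSfg φ hσ hφ hu
      (e := x + s - v) (sub_mem (add_mem hxσ hs) (ppow_add_one_le σ hv))
      (by rw [smul_sub, hpv, sub_self]) (by
        intro s' hs' h
        refine hx (s + s') (add_mem s.2 hs') ?_
        have := add_mem h hv
        rwa [show x + (s : G) - v + s' + v = x + (s + s') by abel] at this)
    rw [hφ_add] at hpw
    refine ⟨w + e - φ s, ?_, ?_, ?_⟩
    · exact sub_mem (add_mem (ppow_add_one_le σ hw) he) ((hφ s σ hσα).1 hs)
    · rw [smul_sub, smul_add, hpw, hpe, add_zero, add_sub_cancel_right]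
    · intro t ht h
      refine heT (t - φ s) (sub_mem ht (φ s).2) ?_
      have := sub_mem h hw
      rwa [show w + e - (φ s : H) + t - w = e + (t - φ s) by abel] at this
  · push Not at hA
    obtain ⟨y, hy, hpy⟩ := mem_ppow_add_one.1
      ((hφ ⟨p • x, hpx⟩ _ hσ.le).1 (smul_mem_ppow_add_one hxσ))
    refine ⟨y, hy, hpy, fun t ht hyt => ?_⟩
    obtain ⟨s, hs⟩ := φ.surjective ⟨t, ht⟩
    obtain rfl : (φ s : H) = t := by rw [hs]
    refine hA s ((hφ s σ hσα).2 ((add_mem_cancel_left hy).1 (ppow_add_one_le σ hyt))) ?_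
    have h := (hφ (⟨p • x, hpx⟩ + p • s) _ hσ₂).2
    rw [hφ_add, ← hpy, ← smul_add] at h
    simpa [smul_add] using h (smul_mem_ppow_add_one hyt)

theorem mem_ppow_extension_iff [IsDomain R] [IsPrincipalIdealRing R] (hp : Prime p)
    (φ : S ≃ₗ[R] T) {α σ : Ordinal.{u}}
    (hφ : ∀ z : S, ∀ β ≤ α, ((z : G) ∈ ppow p β ↔ (φ z : H) ∈ ppow p β))
    {x : G} (hxσ : x ∈ ppow p σ) (hpx : p • x ∈ S) (hx : ∀ s ∈ S, x + s ∉ ppow p (σ + 1))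
    {y : H} (hyσ : y ∈ ppow p σ) (hpy : p • y = (φ ⟨p • x, hpx⟩ : H))
    (hy : ∀ t ∈ T, y + t ∉ ppow p (σ + 1)) (s : S) (r : R) :
    ((s : G) + r • x = 0 ↔ (φ s : H) + r • y = 0) ∧
      ∀ β ≤ α, ((s : G) + r • x ∈ ppow p β ↔ (φ s : H) + r • y ∈ ppow p β) := by
  by_cases hr : p ∣ r
  · obtain ⟨c, rfl⟩ := hr
    have h₁ : (s : G) + (p * c) • x = ↑(s + c • (⟨p • x, hpx⟩ : S)) := by
      simp [mul_comm p c, mul_smul]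
    have h₂ : (φ s : H) + (p * c) • y = ↑(φ (s + c • (⟨p • x, hpx⟩ : S))) := by
      rw [map_add, map_smul, Submodule.coe_add, Submodule.coe_smul, mul_comm, mul_smul, hpy]
    rw [h₁, h₂]
    refine ⟨?_, fun β hβ => hφ _ β hβ⟩
    rw [ZeroMemClass.coe_eq_zero, ZeroMemClass.coe_eq_zero, EmbeddingLike.map_eq_zero_iff]
  · obtain ⟨b, u, hbu⟩ := hp.irreducible.coprime_iff_not_dvd.2 hr
    have hu : IsCoprime u p := ⟨r, b, by rw [mul_comm r, mul_comm b, ← hbu]; ring⟩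
    have hur : u * r = 1 - b * p := eq_sub_of_add_eq' hbu
    set s' : S := u • s - b • ⟨p • x, hpx⟩ with hs'
    have h₁ : u • ((s : G) + r • x) = x + s' := by
      simp only [hs', smul_add, smul_smul, hur, sub_smul, one_smul, Submodule.coe_sub,
        Submodule.coe_smul]
      abel
    have h₂ : u • ((φ s : H) + r • y) = y + φ s' := by
      simp only [hs', smul_add, hur, sub_smul, one_smul, Submodule.coe_sub, map_sub, map_smul,
        Submodule.coe_smul, ← hpy, smul_smul]
      abel
    have key : ∀ β ≤ α, ((s : G) + r • x ∈ ppow p β ↔ (φ s : H) + r • y ∈ ppow p β) := by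
      intro β hβ
      rw [← smul_mem_ppow_iff hu, h₁, ← smul_mem_ppow_iff hu (z := (φ s : H) + r • y), h₂]
      rcases le_or_gt β σ with h | h
      · rw [add_mem_cancel_left (ppow_antitone h hxσ), add_mem_cancel_left (ppow_antitone h hyσ),
          hφ _ β hβ]
      · have h := Order.add_one_le_iff.2 h
        exact iff_of_false (fun hm => hx _ s'.2 (ppow_antitone h hm))
          (fun hm => hy _ (φ s').2 (ppow_antitone h hm))
    refine ⟨iff_of_false (fun h => ?_) (fun h => ?_), key⟩
    · exact hx _ s'.2 (by rw [← h₁, h, smul_zero]; exact zero_mem _)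
    · exact hy _ (φ s').2 (by rw [← h₂, h, smul_zero]; exact zero_mem _)

end Extension

end UlmW

theorem statement_8 {R : Type*} [CommRing R] [IsDomain R] [IsPrincipalIdealRing R]
    {G H : Type u} [AddCommGroup G] [Module R G] [AddCommGroup H] [Module R H]
    (p : R) (hp : Prime p) (S : Submodule R G) (hSfg : S.FG) (T : Submodule R H)
    (φ : S ≃ₗ[R] T) (α : Ordinal.{u})
    (hφ : ∀ z : S, (pheight p (z : G) < (α : WithTop Ordinal.{u}) →
            pheight p ((φ z : H)) = pheight p (z : G)) ∧
          ((α : WithTop Ordinal.{u}) ≤ pheight p (z : G) →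
            (α : WithTop Ordinal.{u}) ≤ pheight p ((φ z : H))))
    (hu : ∀ σ : Ordinal.{u}, σ < α → uHat p G σ ≤ uHat p H σ)
    (x : G) (hx : IsProper p S x) (hpx : p • x ∈ S)
    (hxα : pheight p x + 1 < (α : WithTop Ordinal.{u})) :
    ∃ y : H, ∃ ψ : ↥(S ⊔ Submodule.span R {x}) ≃ₗ[R] ↥(T ⊔ Submodule.span R {y}),
      (∀ z : S, (ψ ⟨(z : G), Submodule.mem_sup_left z.2⟩ : H) = (φ z : H)) ∧
      (ψ ⟨x, Submodule.mem_sup_right (Submodule.mem_span_singleton_self x)⟩ : H) = y ∧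
      ∀ z : ↥(S ⊔ Submodule.span R {x}),
        (pheight p (z : G) < (α : WithTop Ordinal.{u}) →
          pheight p ((ψ z : H)) = pheight p (z : G)) ∧
        ((α : WithTop Ordinal.{u}) ≤ pheight p (z : G) →
          (α : WithTop Ordinal.{u}) ≤ pheight p ((ψ z : H))) := by
  simp only [preserves_pheight_iff] at hφ ⊢
  obtain ⟨σ, hσ⟩ : ∃ σ : Ordinal.{u}, (σ : WithTop Ordinal.{u}) = pheight p x :=
    WithTop.ne_top_iff_exists.1 fun h => by simp [h] at hxα
  have hσα : σ + 1 < α := by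
    rw [← hσ] at hxα
    exact_mod_cast hxα
  have hxσ : x ∈ ppow p σ := coe_le_pheight_iff.1 hσ.le
  have hxS : ∀ s ∈ S, x + s ∉ ppow p (σ + 1) := by
    intro s hs h
    have := (coe_le_pheight_iff.2 h).trans ((hx s hs).trans hσ.ge)
    exact (WithTop.coe_le_coe.1 this).not_gt (lt_add_one σ)
  have hσ' : σ < α := (lt_add_one σ).trans hσα
  obtain ⟨y, hyσ, hpy, hyT⟩ :=
    exists_image_of_proper hp hSfg φ hσα hφ (hu σ hσ') hxσ hpx hxS
  have key := mem_ppow_extension_iff hp φ hφ hxσ hpx hxS hyσ hpy hyT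
  obtain ⟨ψ, hψ⟩ := exists_linearEquiv_of_ker_eq
    (S.subtype.coprod (LinearMap.toSpanSingleton R G x))
    ((T.subtype ∘ₗ φ.toLinearMap).coprod (LinearMap.toSpanSingleton R H y))
    (by
      ext ⟨s, r⟩
      simpa using (key s r).1)
    (A := S ⊔ Submodule.span R {x}) (B := T ⊔ Submodule.span R {y})
    (by rw [range_coprod_toSpanSingleton, Submodule.range_subtype])
    (by rw [range_coprod_toSpanSingleton, LinearMap.range_comp, LinearEquiv.range,
      Submodule.map_top, Submodule.range_subtype])
  have hψ' : ∀ (s : S) (r : R) (h : (s : G) + r • x ∈ S ⊔ Submodule.span R {x}),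
      (ψ ⟨(s : G) + r • x, h⟩ : H) = (φ s : H) + r • y := fun s r h => hψ (s, r) h
  refine ⟨y, ψ, fun z => ?_, ?_, ?_⟩
  · have h := hψ' z 0
    simp only [zero_smul, add_zero] at h
    exact h (Submodule.mem_sup_left z.2)
  · have h := hψ' 0 1
    simp only [one_smul, Submodule.coe_zero, map_zero, zero_add] at h
    exact h (Submodule.mem_sup_right (Submodule.mem_span_singleton_self x))
  · rintro ⟨z, hz⟩
    obtain ⟨s, hs, _, hr, rfl⟩ := Submodule.mem_sup.1 hz
    obtain ⟨r, rfl⟩ := Submodule.mem_span_singleton.1 hr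
    rw [hψ' ⟨s, hs⟩ r]
    exact (key ⟨s, hs⟩ r).2

end
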